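/- arXiv:2403.08562 — 8 statements merged into one kernel-verified Lean document; each statement's English description precedes it below -/
import Mathlib

section
/- Let G be a finite simple graph and let u, v be distinct vertices with κ(G, u, v) = κ(G). Define G' = G − uv if uv ∈ E(G), and G' = G + uv otherwise. Then for every set S ⊆ V(G) with |S| < κ(G), the graphs G ∖ S and G' ∖ S have exactly the same connected components; equivalently, for all x, y ∈ V(G) ∖ S, x and y are in the same connected component of G ∖ S if and only if they are in the same connected component of G' ∖ S. -/
/-- `P` is a family of internally vertex-disjoint paths between `u` and `v` in `G`,
each having at least one internal vertex (i.e. length at least 2). -/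
def InternallyDisjointPaths {V : Type*} (G : SimpleGraph V) {u v : V} {n : ℕ}
    (P : Fin n → G.Path u v) : Prop :=
  (∀ i, 2 ≤ (P i).val.length) ∧
    ∀ i j, i ≠ j →
      List.Disjoint ((P i).val.support.tail.dropLast) ((P j).val.support.tail.dropLast)

/-- `κ(G, u, v)`: the maximum number of internally vertex-disjoint paths between
`u` and `v` in `G`, each having at least one internal vertex. -/
noncomputable def kappa {V : Type*} (G : SimpleGraph V) (u v : V) : ℕ :=
  sSup {n | ∃ P : Fin n → G.Path u v, InternallyDisjointPaths G P}

/-- `κ(G)`: the maximum of `κ(G, u, v)` over all pairs of distinct vertices. -/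
noncomputable def kappaMax {V : Type*} (G : SimpleGraph V) : ℕ :=
  sSup {n | ∃ u v : V, u ≠ v ∧ kappa G u v = n}

/-- `x` and `y` lie in the same connected component of `G ∖ S`, i.e. there is a
walk from `x` to `y` in `G` all of whose vertices avoid `S`. -/
def ConnAvoiding {V : Type*} (G : SimpleGraph V) (S : Set V) (x y : V) : Prop :=
  ∃ p : G.Walk x y, ∀ z ∈ p.support, z ∉ S

open SimpleGraph in
/-- A path of length at least two does not use the edge joining its ends. -/
theorem not_mem_edges_of_isPath_of_two_le_length {V : Type*} {G : SimpleGraph V} {u v : V}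
    {p : G.Walk u v} (hp : p.IsPath) (hl : 2 ≤ p.length) : s(u, v) ∉ p.edges := by
  cases p with
  | nil => simp at hl
  | cons h q =>
    rw [Walk.cons_isPath_iff] at hp
    rw [Walk.edges_cons, List.mem_cons, not_or]
    refine ⟨fun he => ?_, fun he => hp.2 (q.fst_mem_support_of_mem_edges he)⟩
    obtain rfl := Sym2.congr_right.1 he
    rw [Walk.length_cons, (Walk.isPath_iff_nil.1 hp.1).length_eq_zero] at hl
    omega

open SimpleGraph in
/-- A vertex of a walk other than its ends is an internal vertex. -/
theorem mem_support_tail_dropLast {V : Type*} {G : SimpleGraph V} {u v z : V}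
    {p : G.Walk u v} (hz : z ∈ p.support) (hu : z ≠ u) (hv : z ≠ v) :
    z ∈ p.support.tail.dropLast := by
  have ht : z ∈ p.support.tail := ((Walk.mem_support_iff p).1 hz).resolve_left hu
  have hne : p.support.tail ≠ [] := List.ne_nil_of_mem ht
  rw [← List.dropLast_append_getLast hne, List.mem_append, List.mem_singleton,
    List.getLast_tail, Walk.getLast_support] at ht
  exact ht.resolve_right hv

/-- When the supremum is positive it is attained. -/
theorem exists_internallyDisjointPaths_kappa {V : Type*} {G : SimpleGraph V} {u v : V}
    (h : 0 < kappa G u v) :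
    ∃ P : Fin (kappa G u v) → G.Path u v, InternallyDisjointPaths G P := by
  have hb : BddAbove {n | ∃ P : Fin n → G.Path u v, InternallyDisjointPaths G P} := by
    by_contra hb
    exact h.ne' (Nat.sSup_of_not_bddAbove hb)
  have hne : {n | ∃ P : Fin n → G.Path u v, InternallyDisjointPaths G P}.Nonempty :=
    ⟨0, fun i => i.elim0, fun i => i.elim0, fun i => i.elim0⟩
  exact Nat.sSup_mem hne hb

open SimpleGraph in
/-- Fewer than `κ(G, u, v)` vertices do not separate `u` from `v`, even after deleting `uv`. -/
theorem connAvoiding_deleteEdges_of_card_lt_kappa {V : Type*} {G : SimpleGraph V} {u v : V}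
    {S : Finset V} (hS : S.card < kappa G u v) (hu : u ∉ S) (hv : v ∉ S) :
    ConnAvoiding (G.deleteEdges {s(u, v)}) (S : Set V) u v := by
  obtain ⟨P, hlen, hdisj⟩ := exists_internallyDisjointPaths_kappa (S.card.zero_le.trans_lt hS)
  obtain ⟨i, hi⟩ : ∃ i, ∀ z ∈ (P i).val.support, z ∉ S := by
    by_contra! hc
    choose f hf hfS using hc
    have hint : ∀ i, f i ∈ (P i).val.support.tail.dropLast := fun i =>
      mem_support_tail_dropLast (hf i) (fun h => hu (h ▸ hfS i)) (fun h => hv (h ▸ hfS i))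
    have hinj : Function.Injective f := fun i j hij => by
      by_contra hne
      exact hdisj i j hne (hint i) (hij ▸ hint j)
    have hcard := Finset.card_le_card_of_injOn (s := Finset.univ) (t := S) f
      (fun i _ => hfS i) hinj.injOn
    rw [Finset.card_univ, Fintype.card_fin] at hcard
    omega
  refine ⟨(P i).val.toDeleteEdge _
    (not_mem_edges_of_isPath_of_two_le_length (P i).property (hlen i)), fun z hz => ?_⟩
  exact hi z (by simpa [Walk.toDeleteEdge, Walk.toDeleteEdges] using hz)

theorem ConnAvoiding.symm {V : Type*} {G : SimpleGraph V} {S : Set V} {x y : V}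
    (h : ConnAvoiding G S x y) : ConnAvoiding G S y x := by
  obtain ⟨p, hp⟩ := h
  exact ⟨p.reverse, by simpa using hp⟩

theorem ConnAvoiding.trans {V : Type*} {G : SimpleGraph V} {S : Set V} {x y z : V}
    (h : ConnAvoiding G S x y) (h' : ConnAvoiding G S y z) : ConnAvoiding G S x z := by
  obtain ⟨p, hp⟩ := h
  obtain ⟨q, hq⟩ := h'
  refine ⟨p.append q, fun w hw => ?_⟩
  rw [SimpleGraph.Walk.mem_support_append_iff] at hw
  exact hw.elim (hp w) (hq w)

theorem ConnAvoiding.mono {V : Type*} {G H : SimpleGraph V} {S : Set V} {x y : V}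
    (hle : G ≤ H) (h : ConnAvoiding G S x y) : ConnAvoiding H S x y := by
  obtain ⟨p, hp⟩ := h
  exact ⟨p.mapLe hle, by simpa using hp⟩

/-- If the ends of each edge of `G` outside `S` are connected in `H ∖ S`, then vertices connected
in `G ∖ S` are connected in `H ∖ S`. -/
theorem ConnAvoiding.of_adj {V : Type*} {G H : SimpleGraph V} {S : Set V}
    (hadj : ∀ a b, G.Adj a b → a ∉ S → b ∉ S → ConnAvoiding H S a b) {x y : V}
    (h : ConnAvoiding G S x y) : ConnAvoiding H S x y := by
  obtain ⟨p, hp⟩ := h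
  induction p with
  | nil => exact ⟨.nil, by simpa using hp⟩
  | cons hab q ih =>
    simp only [SimpleGraph.Walk.support_cons, List.mem_cons, forall_eq_or_imp] at hp
    exact (hadj _ _ hab hp.1 (hp.2 _ q.start_mem_support)).trans (ih hp.2)

/-- Deleting the edge `uv` does not change connectivity outside a set of fewer than `κ(G, u, v)`
vertices, for every graph `H` that differs from `G` at most in `uv`. -/
theorem connAvoiding_iff_deleteEdges {V : Type*} {G H : SimpleGraph V} {u v : V} {S : Finset V}
    (hS : S.card < kappa G u v) (hH : H.deleteEdges {s(u, v)} = G.deleteEdges {s(u, v)})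
    (x y : V) :
    ConnAvoiding H (S : Set V) x y ↔
      ConnAvoiding (G.deleteEdges {s(u, v)}) (S : Set V) x y := by
  refine ⟨ConnAvoiding.of_adj fun a b hab ha hb => ?_,
    ConnAvoiding.mono (hH ▸ H.deleteEdges_le _)⟩
  by_cases he : s(a, b) = s(u, v)
  · obtain ⟨rfl, rfl⟩ | ⟨rfl, rfl⟩ := Sym2.eq_iff.1 he
    · exact connAvoiding_deleteEdges_of_card_lt_kappa hS (by simpa using ha) (by simpa using hb)
    · exact (connAvoiding_deleteEdges_of_card_lt_kappa hS (by simpa using hb)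
        (by simpa using ha)).symm
  · have hab' : (G.deleteEdges {s(u, v)}).Adj a b := by
      rw [← hH, SimpleGraph.deleteEdges_adj]
      exact ⟨hab, he⟩
    exact ⟨hab'.toWalk, by simpa using ⟨ha, hb⟩⟩

/-- Let `u ≠ v` with `κ(G,u,v) = κ(G)`, and let `G'` be `G - uv` if `uv ∈ E(G)`
and `G + uv` otherwise. Then for every `S` with `|S| < κ(G)`, the graphs
`G ∖ S` and `G' ∖ S` have exactly the same connected components. -/
theorem stmt1 {V : Type*} [Fintype V] (G G' : SimpleGraph V) (u v : V) (huv : u ≠ v)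
    (hkap : kappa G u v = kappaMax G)
    (hdel : G.Adj u v → G' = G.deleteEdges {s(u, v)})
    (hadd : ¬G.Adj u v → G' = G ⊔ SimpleGraph.fromEdgeSet {s(u, v)}) :
    ∀ S : Finset V, S.card < kappaMax G → ∀ x y : V, x ∉ S → y ∉ S →
      (ConnAvoiding G ↑S x y ↔ ConnAvoiding G' ↑S x y) := by
  intro S hS x y _ _
  rw [← hkap] at hS
  have hG' : G'.deleteEdges {s(u, v)} = G.deleteEdges {s(u, v)} := by
    by_cases h : G.Adj u v
    · rw [hdel h, SimpleGraph.deleteEdges_deleteEdges, Set.union_self]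
    · rw [hadd h]
      ext a b
      simp only [SimpleGraph.deleteEdges_adj, SimpleGraph.sup_adj,
        SimpleGraph.fromEdgeSet_adj]
      tauto
  rw [connAvoiding_iff_deleteEdges hS rfl, connAvoiding_iff_deleteEdges hS hG']
end

section
/- Let G be a finite simple graph and let k be an integer with κ(G) ≤ k. Then for all distinct vertices u, v ∈ V(G): u and v are non-adjacent in G if and only if there exists a set S ⊆ V(G) ∖ {u, v} with |S| ≤ k such that u and v lie in different connected components of G ∖ S. -/
namespace InternallyDisjointPaths

variable {V : Type*} {G : SimpleGraph V} {u v : V}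

/-- Every internally disjoint family is at most as large as the vertex set. -/
theorem le_card [Fintype V] {n : ℕ} {P : Fin n → G.Path u v}
    (hP : InternallyDisjointPaths G P) : n ≤ Fintype.card V := by
  have hne : ∀ i, ∃ x, x ∈ (P i).val.support.tail.dropLast := by
    intro i
    apply List.exists_mem_of_ne_nil
    have h := hP.1 i
    rw [← List.length_pos_iff]
    simp only [List.length_dropLast, List.length_tail, SimpleGraph.Walk.length_support]
    omega
  choose x hx using hne
  have hinj : Function.Injective x := by
    intro i j hij
    by_contra h
    exact hP.2 i j h (hx i) (hij ▸ hx j)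
  simpa using Fintype.card_le_of_injective x hinj

theorem le_kappa [Fintype V] {n : ℕ} {P : Fin n → G.Path u v}
    (hP : InternallyDisjointPaths G P) : n ≤ kappa G u v :=
  le_csSup ⟨Fintype.card V, fun _ ⟨_, hQ⟩ => hQ.le_card⟩ ⟨P, hP⟩

end InternallyDisjointPaths

theorem kappa_le_card {V : Type*} [Fintype V] (G : SimpleGraph V) (u v : V) :
    kappa G u v ≤ Fintype.card V :=
  csSup_le' fun _ ⟨_, hQ⟩ => hQ.le_card

theorem kappa_le_kappaMax {V : Type*} [Fintype V] (G : SimpleGraph V) {u v : V} (huv : u ≠ v) :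
    kappa G u v ≤ kappaMax G := by
  refine le_csSup ⟨Fintype.card V, ?_⟩ ⟨u, v, huv, rfl⟩
  rintro _ ⟨a, b, -, rfl⟩
  exact kappa_le_card G a b

section Menger

variable {V : Type*} (G : SimpleGraph V) (u v : V) (k : ℕ)

/-- The bipartite relation to which Hall's theorem is applied in the proof of Menger's theorem:
the left copies of `Fin k` stand for `u`, the right copies for `v`, and every vertex
may be matched to itself or to a neighbour. -/
def MengerRel : V ⊕ Fin k → V ⊕ Fin k → Prop
  | .inl x, .inl y => x = y ∨ (G.Adj x y ∧ x ≠ v)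
  | .inl x, .inr _ => G.Adj x v
  | .inr _, .inl y => G.Adj u y
  | .inr _, .inr _ => False

variable {G u v k}

/-- If `X` has no neighbour of `v`, then the neighbours of `X ∪ {u}` outside `X ∪ {u}`
separate `u` from `v`. -/
theorem not_connAvoiding_of_boundary {X S : Set V} (huv : u ≠ v) (hadj : ¬ G.Adj u v)
    (hX : ∀ x ∈ X, ¬ G.Adj x v)
    (hS : ∀ y, y ∉ X → y ≠ u → ((∃ x ∈ X, G.Adj x y ∧ x ≠ v) ∨ G.Adj u y) → y ∈ S) :
    ¬ ConnAvoiding G S u v := by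
  rintro ⟨p, hp⟩
  suffices h : ∀ {a b : V} (q : G.Walk a b), (∀ z ∈ q.support, z ∉ S) →
      (a = u ∨ a ∈ X) → a ≠ v → b ≠ v from h p hp (Or.inl rfl) huv rfl
  intro a b q
  induction q with
  | nil => exact fun _ _ h => h
  | @cons a c b hac q ih =>
    intro hq ha hav
    have hcS : c ∉ S := hq c (by simp)
    refine ih (fun z hz => hq z (by simp [hz])) ?_ ?_
    · by_contra! h
      refine hcS (hS c h.2 h.1 ?_)
      rcases ha with rfl | ha
      · exact Or.inr hac
      · exact Or.inl ⟨a, ha, hac, hav⟩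
    · rintro rfl
      rcases ha with rfl | ha
      · exact hadj hac
      · exact hX a ha hac

theorem exists_injective_mengerRel [Fintype V] (huv : u ≠ v) (hadj : ¬ G.Adj u v)
    (hsep : ∀ S : Finset V, u ∉ S → v ∉ S → ¬ ConnAvoiding G ↑S u v → k ≤ S.card) :
    ∃ f : V ⊕ Fin k → V ⊕ Fin k, Function.Injective f ∧ ∀ x, MengerRel G u v k x (f x) := by
  classical
  have hall := (Finset.all_card_le_biUnion_card_iff_exists_injective
    (fun x : V ⊕ Fin k => Finset.univ.filter (MengerRel G u v k x))).1 ?_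
  · simpa using hall
  intro s
  have hs : s.card = s.toLeft.card + s.toRight.card := s.card_toLeft_add_card_toRight.symm
  have hright : s.toRight.card ≤ k := by simpa using s.toRight.card_le_univ
  set N := s.biUnion fun x => Finset.univ.filter (MengerRel G u v k x) with hN
  have hNmem : ∀ y, y ∈ N ↔ ∃ x ∈ s, MengerRel G u v k x y := by simp [hN]
  have hNcard : N.card = N.toLeft.card + N.toRight.card := N.card_toLeft_add_card_toRight.symm
  have hleft : s.toLeft ⊆ N.toLeft := by
    intro x hx
    rw [Finset.mem_toLeft] at hx ⊢
    exact (hNmem _).2 ⟨_, hx, Or.inl rfl⟩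
  have hleft' := Finset.card_le_card hleft
  rcases s.toRight.eq_empty_or_nonempty with he | ⟨i, hi⟩
  · rw [he, Finset.card_empty] at hs
    omega
  rw [Finset.mem_toRight] at hi
  by_cases hv : ∃ x ∈ s.toLeft, G.Adj x v
  · obtain ⟨x, hx, hxv⟩ := hv
    have huniv : N.toRight = Finset.univ := by
      ext j
      simp only [Finset.mem_toRight, Finset.mem_univ, iff_true]
      exact (hNmem _).2 ⟨_, Finset.mem_toLeft.1 hx, hxv⟩
    have : N.toRight.card = k := by simp [huniv]
    omega
  · push Not at hv
    have hk : k ≤ (N.toLeft \ insert u s.toLeft).card := by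
      refine hsep _ (by simp) ?_ (not_connAvoiding_of_boundary (X := ↑s.toLeft) huv hadj hv ?_)
      · intro h
        simp only [Finset.mem_sdiff, Finset.mem_insert, not_or, Finset.mem_toLeft] at h
        obtain ⟨x | j, hx, hr⟩ := (hNmem _).1 h.1
        · rcases hr with rfl | hr
          · exact h.2.2 hx
          · exact hv x (Finset.mem_toLeft.2 hx) hr.1
        · exact hadj hr
      · intro y hy hyu h
        simp only [Finset.mem_coe, Finset.mem_toLeft] at hy h
        simp only [Finset.coe_sdiff, Set.mem_sdiff, Finset.mem_coe, Finset.mem_insert, not_or,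
          Finset.mem_toLeft]
        refine ⟨(hNmem _).2 ?_, hyu, hy⟩
        rcases h with ⟨x, hx, hxy⟩ | h
        · exact ⟨_, hx, Or.inr hxy⟩
        · exact ⟨_, hi, h⟩
    have h₁ : (N.toLeft \ insert u s.toLeft).card ≤ (N.toLeft \ s.toLeft).card :=
      Finset.card_le_card (Finset.sdiff_subset_sdiff subset_rfl (Finset.subset_insert _ _))
    have h₂ := Finset.card_sdiff_add_card_eq_card hleft
    omega

/-- The vertices met when iterating `f` from the `i`-th copy of `u`, before reaching
a copy of `v`. -/
def orbitVertices (f : V ⊕ Fin k → V ⊕ Fin k) (i : Fin k) : Set V :=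
  {w | ∃ m, f^[m] (.inr i) = .inl w ∧ ∀ l, 0 < l → l ≤ m → (f^[l] (.inr i)).isLeft}

theorem disjoint_orbitVertices {f : V ⊕ Fin k → V ⊕ Fin k} (hf : Function.Injective f)
    {i j : Fin k} (hij : i ≠ j) : Disjoint (orbitVertices f i) (orbitVertices f j) := by
  rw [Set.disjoint_left]
  rintro w ⟨a, ha, ha'⟩ ⟨b, hb, hb'⟩
  have key : ∀ {i j : Fin k} {a b : ℕ}, i ≠ j → a ≤ b →
      (∀ l, 0 < l → l ≤ b → (f^[l] (.inr j)).isLeft) →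
      f^[a] (.inr i) ≠ f^[b] (.inr j) := by
    intro i j a b hij hab hl h
    obtain ⟨c, rfl⟩ := Nat.exists_eq_add_of_le hab
    rw [Function.iterate_add_apply] at h
    have h' := hf.iterate a h
    rcases Nat.eq_zero_or_pos c with rfl | hc
    · exact hij (Sum.inr_injective h')
    · have := hl c hc (by omega)
      simp [← h'] at this
  rcases le_total a b with h | h
  · exact key hij h hb' (ha.trans hb.symm)
  · exact key hij.symm h ha' (hb.trans ha.symm)

theorem exists_walk_orbitVertices {f : V ⊕ Fin k → V ⊕ Fin k}
    (hr : ∀ x, MengerRel G u v k x (f x)) (i : Fin k) (m : ℕ)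
    (hm : ∀ l, 0 < l → l ≤ m → (f^[l] (.inr i)).isLeft) :
    ∃ p : G.Walk u (Sum.elim id (fun _ => u) (f^[m] (.inr i))),
      ∀ z ∈ p.support, z = u ∨ z ∈ orbitVertices f i := by
  induction m with
  | zero => exact ⟨.nil, by simp⟩
  | succ m ih =>
    obtain ⟨p, hp⟩ := ih fun l h₀ hl => hm l h₀ (by omega)
    obtain ⟨w, hw⟩ := Sum.isLeft_iff.1 (hm (m + 1) (by omega) le_rfl)
    have hwm : w ∈ orbitVertices f i := ⟨m + 1, hw, hm⟩
    have hstep := hr (f^[m] (.inr i))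
    rw [← Function.iterate_succ_apply' f, hw] at hstep
    rw [hw]
    generalize f^[m] (Sum.inr i) = x at p hp hstep
    have of_adj (h : G.Adj (Sum.elim id (fun _ => u) x) w) :
        ∃ q : G.Walk u w, ∀ z ∈ q.support, z = u ∨ z ∈ orbitVertices f i := by
      refine ⟨p.concat h, fun z hz => ?_⟩
      rw [SimpleGraph.Walk.support_concat, List.mem_append, List.mem_singleton] at hz
      rcases hz with hz | rfl
      · exact hp z hz
      · exact Or.inr hwm
    rcases x with x | j
    · rcases hstep with rfl | h
      · exact ⟨p, hp⟩
      · exact of_adj h.1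
    · exact of_adj hstep

theorem exists_path_orbitVertices [Finite V] {f : V ⊕ Fin k → V ⊕ Fin k}
    (hf : Function.Injective f) (hr : ∀ x, MengerRel G u v k x (f x)) (i : Fin k) :
    ∃ p : G.Path u v, ∀ z ∈ p.val.support, z = u ∨ z = v ∨ z ∈ orbitVertices f i := by
  classical
  have hex : ∃ n, 0 < n ∧ ¬ (f^[n] (.inr i)).isLeft := by
    obtain ⟨n, hn, hper⟩ := hf.mem_periodicPts (.inr i)
    exact ⟨n, hn, by simp [hper.eq]⟩
  obtain ⟨hpos, hnot⟩ := Nat.find_spec hex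
  have hmin : ∀ l, 0 < l → l < Nat.find hex → (f^[l] (.inr i)).isLeft := by
    intro l h₀ hl
    by_contra h
    exact Nat.find_min hex hl ⟨h₀, h⟩
  obtain ⟨m, hm⟩ := Nat.exists_eq_succ_of_ne_zero hpos.ne'
  rw [hm] at hnot hmin
  obtain ⟨p, hp⟩ := exists_walk_orbitVertices hr i m fun l h₀ hl => hmin l h₀ (by omega)
  have hstep := hr (f^[m] (.inr i))
  rw [← Function.iterate_succ_apply' f] at hstep
  obtain ⟨j, hj⟩ := Sum.isRight_iff.1 (Sum.not_isLeft.1 hnot)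
  rw [hj] at hstep
  generalize f^[m] (Sum.inr i) = x at p hp hstep
  rcases x with x | j
  · have hxv : G.Adj (Sum.elim id (fun _ => u) (.inl x : V ⊕ Fin k)) v := hstep
    refine ⟨(p.concat hxv).toPath, fun z hz => ?_⟩
    have hz' := SimpleGraph.Walk.support_toPath_subset_support _ hz
    rw [SimpleGraph.Walk.support_concat, List.mem_append, List.mem_singleton] at hz'
    rcases hz' with hz' | rfl
    · exact (hp z hz').imp_right Or.inr
    · exact Or.inr (Or.inl rfl)
  · exact hstep.elim

/-- An internal vertex of a path differs from both ends. -/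
theorem SimpleGraph.Walk.IsPath.ne_of_mem_tail_dropLast {p : G.Walk u v} (hp : p.IsPath) {z : V}
    (hz : z ∈ p.support.tail.dropLast) : z ≠ u ∧ z ≠ v := by
  have hnd := hp.support_nodup
  constructor
  · rintro rfl
    rw [← p.cons_tail_support] at hnd
    exact (List.nodup_cons.1 hnd).1 (List.dropLast_subset _ hz)
  · rintro rfl
    rw [← List.tail_dropLast] at hz
    have hz' := List.mem_of_mem_tail hz
    rw [← List.dropLast_append_getLast p.support_ne_nil, p.getLast_support] at hnd
    exact List.disjoint_of_nodup_append hnd hz' (by simp)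

/-- **Menger's theorem** for two non-adjacent vertices. -/
theorem exists_internallyDisjointPaths [Fintype V] (huv : u ≠ v) (hadj : ¬ G.Adj u v)
    (hsep : ∀ S : Finset V, u ∉ S → v ∉ S → ¬ ConnAvoiding G ↑S u v → k ≤ S.card) :
    ∃ P : Fin k → G.Path u v, InternallyDisjointPaths G P := by
  obtain ⟨f, hf, hr⟩ := exists_injective_mengerRel huv hadj hsep
  choose P hP using exists_path_orbitVertices hf hr
  refine ⟨P, fun i => ?_, fun i j hij z hzi hzj => ?_⟩
  · by_contra! h
    interval_cases hl : (P i).val.length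
    · exact huv (SimpleGraph.Walk.eq_of_length_eq_zero hl)
    · exact hadj (SimpleGraph.Walk.adj_of_length_eq_one hl)
  · have mem : ∀ l, z ∈ (P l).val.support.tail.dropLast → z ∈ orbitVertices f l := by
      intro l hz
      obtain ⟨h₁, h₂⟩ := (P l).property.ne_of_mem_tail_dropLast hz
      simpa [h₁, h₂] using hP l z (List.mem_of_mem_tail (List.dropLast_subset _ hz))
    exact Set.disjoint_left.1 (disjoint_orbitVertices hf hij) (mem i hzi) (mem j hzj)

end Menger

/-- If `κ(G) ≤ k`, then distinct vertices `u, v` are non-adjacent in `G` iff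
there is a set `S ⊆ V(G) ∖ {u,v}` of size at most `k` such that `u` and `v`
lie in different connected components of `G ∖ S`. -/
theorem stmt3 {V : Type*} [Fintype V] (G : SimpleGraph V) (k : ℤ)
    (hk : (kappaMax G : ℤ) ≤ k) :
    ∀ u v : V, u ≠ v →
      (¬ G.Adj u v ↔
        ∃ S : Finset V, u ∉ S ∧ v ∉ S ∧ (S.card : ℤ) ≤ k ∧ ¬ ConnAvoiding G ↑S u v) := by
  intro u v huv
  constructor
  · intro hadj
    by_contra! h
    obtain ⟨P, hP⟩ := exists_internallyDisjointPaths (k := kappaMax G + 1) huv hadj (by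
      intro S hu hv hS
      by_contra! hlt
      exact hS (h S hu hv (by omega)))
    have := hP.le_kappa.trans (kappa_le_kappaMax G huv)
    omega
  · rintro ⟨S, hu, hv, -, hS⟩ hadj
    refine hS ⟨hadj.toWalk, fun z hz => ?_⟩
    have hz' : z = u ∨ z = v := by simpa using hz
    rcases hz' with rfl | rfl
    · simpa using hu
    · simpa using hv
end

section
/- Let k ≥ 3 and N ≥ 3k be integers, and let G_{N,k} be the graph with vertex set {v_1, …, v_N} in which v_i and v_j are adjacent if and only if 0 < |i − j| ≤ k. Then κ(G_{N,k}) = 2k − 2; that is, the maximum over all pairs of distinct vertices u, v of the maximum number of internally vertex-disjoint u–v paths, each having at least one internal vertex, equals 2k − 2. -/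
/-- The graph `G_{N,k}` with vertices `v_1, …, v_N` (here indexed by `Fin N`)
in which `v_i` and `v_j` are adjacent iff `0 < |i - j| ≤ k`. -/
def intervalGraph (N k : ℕ) : SimpleGraph (Fin N) :=
  SimpleGraph.fromRel (fun i j => (i : ℕ) ≤ (j : ℕ) + k ∧ (j : ℕ) ≤ (i : ℕ) + k)

theorem intervalGraph_adj {N k : ℕ} {i j : Fin N} :
    (intervalGraph N k).Adj i j ↔ i ≠ j ∧ (i : ℕ) ≤ j + k ∧ (j : ℕ) ≤ i + k := by
  simp only [intervalGraph, SimpleGraph.fromRel_adj]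
  tauto

namespace SimpleGraph.Walk

variable {V : Type*} {G : SimpleGraph V}

theorem mem_support_tail_dropLast {u v z : V} (p : G.Walk u v) (hz : z ∈ p.support)
    (hu : z ≠ u) (hv : z ≠ v) : z ∈ p.support.tail.dropLast := by
  cases p with
  | nil => simp_all
  | cons h q =>
    have hq : z ∈ q.support := by simpa [hu] using hz
    rw [← List.dropLast_append_getLast q.support_ne_nil, List.mem_append] at hq
    simpa [hv] using hq

/-- A property that propagates along edges into the support of a walk holds at its end. -/
theorem property_of_forall_adj {Q : V → Prop} {x y : V} (p : G.Walk x y) (hx : Q x)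
    (hQ : ∀ u v, G.Adj u v → v ∈ p.support → Q u → Q v) : Q y := by
  induction p with
  | nil => exact hx
  | cons h q ih =>
    exact ih (hQ _ _ h (by simp) hx) fun u v huv hv => hQ u v huv (by simp [hv])

end SimpleGraph.Walk

/-- The easy direction of Menger's theorem: a set meeting the interior of every path of length at
least two bounds the size of any internally disjoint family. -/
theorem InternallyDisjointPaths.le_card_s8 {V : Type*} {G : SimpleGraph V} {u v : V} {n : ℕ}
    {P : Fin n → G.Path u v} (hP : InternallyDisjointPaths G P) (S : Finset V)
    (hS : ∀ p : G.Walk u v, p.IsPath → 2 ≤ p.length → ∃ z ∈ p.support, z ∈ S)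
    (hu : u ∉ S) (hv : v ∉ S) : n ≤ S.card := by
  choose f hf hfS using fun i => hS (P i).1 (P i).2 (hP.1 i)
  have hint (i) : f i ∈ (P i).1.support.tail.dropLast :=
    (P i).1.mem_support_tail_dropLast (hf i) (ne_of_mem_of_not_mem (hfS i) hu)
      (ne_of_mem_of_not_mem (hfS i) hv)
  have hinj : Function.Injective f := by
    intro i j hij
    by_contra hne
    exact hP.2 i j hne (hint i) (hij ▸ hint j)
  simpa using Finset.card_le_card_of_injOn (s := Finset.univ) f (fun i _ => hfS i) hinj.injOn

theorem exists_separator_of_lt {N k : ℕ} (hk : 2 ≤ k) {a b : Fin N} (hab : a < b) :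
    ∃ S : Finset (Fin N), S.card ≤ 2 * k - 2 ∧ a ∉ S ∧ b ∉ S ∧
      ∀ p : (intervalGraph N k).Walk a b, p.IsPath → 2 ≤ p.length →
        ∃ z ∈ p.support, z ∈ S := by
  have hab' : (a : ℕ) < b := hab
  by_cases hd : (b : ℕ) ≤ a + k
  · let T := ((Finset.Icc ((b : ℕ) - k) (a + k)).erase a).erase b
    refine ⟨Finset.univ.filter fun z => (z : ℕ) ∈ T, ?_, by simp [T], by simp [T], ?_⟩
    · have h1 := Finset.card_le_card_of_injOn (s := Finset.univ.filter fun z : Fin N => (z : ℕ) ∈ T)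
        (t := T) Fin.val (fun z hz => by simpa using hz) Fin.val_injective.injOn
      have h2 : T.card = (a + k + 1 - (b - k)) - 1 - 1 := by
        rw [Finset.card_erase_of_mem, Finset.card_erase_of_mem, Nat.card_Icc]
        · simp; omega
        · simp; omega
      omega
    · intro p hp hlen
      by_contra! hS
      cases p with
      | nil => simp at hlen
      | @cons _ x _ h q =>
        rw [SimpleGraph.Walk.cons_isPath_iff] at hp
        have hxb : x ≠ b := by
          rintro rfl
          have := SimpleGraph.Walk.length_eq_zero_iff.2 (SimpleGraph.Walk.isPath_iff_nil.1 hp.1)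
          simp [this] at hlen
        have key (z : Fin N) (hz : z ∈ q.support) (hzb : z ≠ b) (hza : (z : ℕ) ≤ a + k) :
            (z : ℕ) + k < b := by
          have h1 := hS z (by simp [hz])
          have h2 : z ≠ a := by rintro rfl; exact hp.2 hz
          simp only [T, Finset.mem_filter, Finset.mem_univ, true_and, Finset.mem_erase,
            Finset.mem_Icc] at h1
          rw [Ne, Fin.ext_iff] at h2 hzb
          omega
        have := q.property_of_forall_adj (Q := fun z : Fin N => (z : ℕ) + k < b)
          (key x (by simp) hxb (intervalGraph_adj.1 h).2.2) fun u v huv hv hu => by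
            have := (intervalGraph_adj.1 huv).2.2
            exact key v hv (by rintro rfl; omega) (by omega)
        omega
  · let T := Finset.Ioc (a : ℕ) (a + k)
    refine ⟨Finset.univ.filter fun z => (z : ℕ) ∈ T, ?_, by simp [T], by simp [T]; omega, ?_⟩
    · have h1 := Finset.card_le_card_of_injOn (s := Finset.univ.filter fun z : Fin N => (z : ℕ) ∈ T)
        (t := T) Fin.val (fun z hz => by simpa using hz) Fin.val_injective.injOn
      have h2 : T.card = k := by simp [T]
      omega
    · intro p _ _
      by_contra! hS
      have := p.property_of_forall_adj (Q := fun z : Fin N => (z : ℕ) ≤ a) le_rfl fun u v huv hv hu => by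
        have h1 := (intervalGraph_adj.1 huv).2.2
        have h2 := hS v hv
        simp only [T, Finset.mem_filter, Finset.mem_univ, true_and, Finset.mem_Ioc] at h2
        omega
      omega

theorem InternallyDisjointPaths.intervalGraph_le {N k n : ℕ} (hk : 2 ≤ k) {u v : Fin N}
    (huv : u ≠ v) {P : Fin n → (intervalGraph N k).Path u v}
    (hP : InternallyDisjointPaths (intervalGraph N k) P) : n ≤ 2 * k - 2 := by
  rcases huv.lt_or_gt with h | h
  · obtain ⟨S, hc, hu, hv, hS⟩ := exists_separator_of_lt hk h
    exact (hP.le_card_s8 S hS hu hv).trans hc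
  · obtain ⟨S, hc, hv, hu, hS⟩ := exists_separator_of_lt hk h
    exact (hP.le_card_s8 S (fun p hp hl => by simpa using hS p.reverse hp.reverse (by simpa)) hu hv).trans hc

/-- Consecutive vertices far enough from the ends have `2k - 2` common neighbours. -/
theorem exists_internallyDisjointPaths_intervalGraph {N k : ℕ} (hk : 1 ≤ k) (hN : 2 * k ≤ N) :
    ∃ u v : Fin N, u ≠ v ∧ ∃ P : Fin (2 * k - 2) → (intervalGraph N k).Path u v,
      InternallyDisjointPaths (intervalGraph N k) P := by
  let u : Fin N := ⟨k - 1, by omega⟩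
  let v : Fin N := ⟨k, by omega⟩
  let f (i : Fin (2 * k - 2)) : Fin N := ⟨if (i : ℕ) < k - 1 then i else i + 2, by split <;> omega⟩
  have huv : u ≠ v := by simp [u, v, Fin.ext_iff]; omega
  have hu (i) : (intervalGraph N k).Adj u (f i) := by
    rw [intervalGraph_adj, Ne, Fin.ext_iff]
    dsimp only [u, f]
    split <;> omega
  have hv (i) : (intervalGraph N k).Adj (f i) v := by
    rw [intervalGraph_adj, Ne, Fin.ext_iff]
    dsimp only [v, f]
    split <;> omega
  refine ⟨u, v, huv, fun i => ⟨.cons (hu i) (.cons (hv i) .nil), ?_⟩, ?_, ?_⟩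
  · simp [SimpleGraph.Walk.cons_isPath_iff, (hu i).ne, (hv i).ne, huv]
  · simp
  · intro i j hij
    have : f i ≠ f j := by
      rw [Ne, Fin.ext_iff] at hij ⊢
      dsimp only [f]
      split <;> split <;> omega
    simpa using this.symm

/-- For `k ≥ 3` and `N ≥ 3k`, the maximum pairwise connectivity of `G_{N,k}`
is exactly `2k - 2`. -/
theorem stmt8 (N k : ℕ) (hk : 3 ≤ k) (hN : 3 * k ≤ N) :
    kappaMax (intervalGraph N k) = 2 * k - 2 := by
  have hle {u v : Fin N} (huv : u ≠ v) : 2 * k - 2 ∈ upperBounds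
      {n | ∃ P : Fin n → (intervalGraph N k).Path u v,
        InternallyDisjointPaths (intervalGraph N k) P} :=
    fun _ ⟨_, hP⟩ => hP.intervalGraph_le (by omega) huv
  have hub : 2 * k - 2 ∈ upperBounds {n | ∃ u v : Fin N, u ≠ v ∧ kappa (intervalGraph N k) u v = n} := by
    rintro _ ⟨u, v, huv, rfl⟩
    exact csSup_le' (hle huv)
  obtain ⟨u, v, huv, hP⟩ :=
    exists_internallyDisjointPaths_intervalGraph (N := N) (k := k) (by omega) (by omega)
  refine le_antisymm (csSup_le' hub) ?_
  exact (le_csSup ⟨_, hle huv⟩ hP).trans (le_csSup ⟨_, hub⟩ ⟨u, v, huv, rfl⟩)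
end

section
/- Let k ≥ 3 and N ≥ k + 1 be integers, let G_{N,k} be the graph with vertex set {v_1, …, v_N} in which v_i and v_j are adjacent if and only if 0 < |i − j| ≤ k, and let G⁻ be the graph obtained from G_{N,k} by removing the edge between v_1 and v_{k+1}. Let S ⊆ V(G_{N,k}) be a set of vertices that does not cover any interval with k − 1 vertices, i.e., there is no a with 1 ≤ a ≤ N − k + 2 such that {v_a, v_{a+1}, …, v_{a+k−2}} ⊆ S. Then the graph G⁻ ∖ S is connected. -/
/-- Distinct vertices at distance less than `k` are adjacent in `G_{N,k}`, also after removing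
an edge of length `k`. -/
lemma intervalGraph_deleteEdges_adj {N k : ℕ} {h0 : 0 < N} {hkN : k < N} {x y : Fin N}
    (hxy : (x : ℕ) < y) (hyx : (y : ℕ) < x + k) :
    ((intervalGraph N k).deleteEdges
      {s((⟨0, h0⟩ : Fin N), (⟨k, hkN⟩ : Fin N))}).Adj x y := by
  rw [SimpleGraph.deleteEdges_adj, intervalGraph, SimpleGraph.fromRel_adj]
  refine ⟨⟨fun h => ?_, Or.inl ⟨by omega, by omega⟩⟩, fun h => ?_⟩
  · rw [h] at hxy
    omega
  · simp only [Set.mem_singleton_iff, Sym2.eq_iff, Fin.ext_iff] at h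
    omega

/-- If `S` contains no `k - 1` consecutive vertices and all pairs at distance less than `k` are
adjacent, then any two vertices outside `S` are joined by a path avoiding `S`. -/
lemma reachable_induce_compl_of_lt {N k : ℕ} (G : SimpleGraph (Fin N)) (S : Set (Fin N))
    (hk : 0 < k) (hG : ∀ x y : Fin N, (x : ℕ) < y → (y : ℕ) < x + k → G.Adj x y)
    (hS : ∀ a : ℕ, a + (k - 1) ≤ N →
      ∃ b : Fin N, a ≤ (b : ℕ) ∧ (b : ℕ) < a + (k - 1) ∧ b ∉ S)
    (x y : ↥Sᶜ) (hxy : (x.1 : ℕ) < y.1) : (G.induce Sᶜ).Reachable x y := by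
  by_cases hyx : (y.1 : ℕ) < x.1 + k
  · exact SimpleGraph.Adj.reachable (SimpleGraph.induce_adj.2 (hG _ _ hxy hyx))
  · have hy := y.1.isLt
    obtain ⟨b, hxb, hbx, hbS⟩ := hS (x.1 + 1) (by omega)
    have hadj : (G.induce Sᶜ).Adj x ⟨b, hbS⟩ :=
      SimpleGraph.induce_adj.2 (hG x.1 b (by omega) (by omega))
    have hby : (b : ℕ) < y.1 := by omega
    exact hadj.reachable.trans (reachable_induce_compl_of_lt G S hk hG hS ⟨b, hbS⟩ y hby)
termination_by (y.1 : ℕ) - x.1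
decreasing_by
  omega

/-- Let `G⁻` be `G_{N,k}` with the edge between the first vertex and the
`(k+1)`-st vertex removed. If `S` does not cover any interval of `k - 1`
consecutive vertices, then `G⁻ ∖ S` is connected. -/
theorem stmt10 (N k : ℕ) (hk : 3 ≤ k) (hN : k + 1 ≤ N) (S : Set (Fin N))
    (hS : ∀ a : ℕ, a + (k - 1) ≤ N →
      ∃ b : Fin N, a ≤ (b : ℕ) ∧ (b : ℕ) < a + (k - 1) ∧ b ∉ S) :
    (((intervalGraph N k).deleteEdges
        {s((⟨0, by omega⟩ : Fin N), (⟨k, by omega⟩ : Fin N))}).induce Sᶜ).Connected := by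
  obtain ⟨b, -, -, hb⟩ := hS 0 (by omega)
  have hreach := reachable_induce_compl_of_lt _ S (by omega)
    (fun _ _ => intervalGraph_deleteEdges_adj (h0 := Nat.zero_lt_of_lt hN) (hkN := hN)) hS
  have : Nonempty ↥Sᶜ := ⟨⟨b, hb⟩⟩
  refine ⟨fun x y => ?_⟩
  rcases lt_trichotomy (x.1 : ℕ) y.1 with h | h | h
  · exact hreach x y h
  · rw [Subtype.ext (Fin.ext h)]
  · exact (hreach y x h).symm
end

section
/- Let n, q, k be integers with n ≥ q ≥ k ≥ 3 and set N = 3qn. Let S ⊆ {1, …, N} be a set with k − 1 ≤ |S| ≤ q and let a be an integer with 1 ≤ a ≤ N − k + 2. Then the number of permutations π of {1, …, N} such that {a, a + 1, …, a + k − 2} ⊆ π(S) (where π(S) denotes the image of S under π) is at most N! / (2n)^{k−1}; equivalently, this number multiplied by (2n)^{k−1} is at most N!. -/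
open Finset in
/-- Among the permutations `π` with `T ⊆ π(S)`, a proportion `(#S - #T) / (N - #T)` also satisfies
`b ∈ π(S)`, for every `b ∉ T`. -/
theorem card_perm_insert_subset_image_mul {α : Type*} [Fintype α] [DecidableEq α]
    (S T : Finset α) (b : α) (hb : b ∉ T) :
    #{π : Equiv.Perm α | insert b T ⊆ S.image π} * (Fintype.card α - #T) =
      #{π : Equiv.Perm α | T ⊆ S.image π} * (#S - #T) := by
  have symm (c : α) (hc : c ∈ Tᶜ) :
      #{π : Equiv.Perm α | insert c T ⊆ S.image π} =
        #{π : Equiv.Perm α | insert b T ⊆ S.image π} := by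
    rw [mem_compl] at hc
    refine card_equiv (Equiv.mulLeft (Equiv.swap b c)) fun π => ?_
    have image_mul : S.image (Equiv.swap b c * π : Equiv.Perm α) =
        (S.image π).image (Equiv.swap b c) := by
      simp [image_image]
    have image_insert_swap : (insert c T).image (Equiv.swap b c) = insert b T := by
      rw [image_insert, Equiv.swap_apply_right]
      congr 1
      conv_rhs => rw [← image_id (s := T)]
      refine image_congr fun x hx => ?_
      exact Equiv.swap_apply_of_ne_of_ne (fun h => hb (h ▸ hx)) (fun h => hc (h ▸ hx))
    simp only [mem_filter_univ, Equiv.coe_mulLeft]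
    rw [image_mul, ← image_insert_swap, image_subset_image_iff (Equiv.injective _)]
  have count : ∑ c ∈ Tᶜ, #{π : Equiv.Perm α | insert c T ⊆ S.image π} =
      ∑ π ∈ univ.filter fun π : Equiv.Perm α => T ⊆ S.image π, #(S.image π \ T) := by
    simp only [card_eq_sum_ones]
    refine sum_comm' fun c π => ?_
    simp only [mem_compl, mem_filter_univ, insert_subset_iff, mem_sdiff]
    tauto
  rw [sum_congr rfl symm, sum_const, card_compl, smul_eq_mul] at count
  rw [mul_comm, count, sum_congr rfl (g := fun _ => #S - #T), sum_const, smul_eq_mul]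
  intro π hπ
  rw [card_sdiff_of_subset (mem_filter.1 hπ).2, card_image_of_injective _ π.injective]

open Finset in
theorem card_perm_subset_image_mul_pow_le {α : Type*} [Fintype α] [DecidableEq α]
    (S T : Finset α) (c : ℕ) (hc : 1 ≤ c) (hS : #S * c ≤ Fintype.card α) :
    #{π : Equiv.Perm α | T ⊆ S.image π} * c ^ #T ≤ (Fintype.card α).factorial := by
  induction T using Finset.induction_on with
  | empty => simp [Fintype.card_perm]
  | insert b T hb ih =>
    have hT : #T < Fintype.card α := card_lt_univ_of_notMem hb
    have ratio : (#S - #T) * c ≤ Fintype.card α - #T := by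
      rw [Nat.sub_mul]
      have := Nat.le_mul_of_pos_right #T hc
      omega
    refine Nat.le_of_mul_le_mul_right ?_ (Nat.sub_pos_of_lt hT)
    rw [card_insert_of_notMem hb]
    calc _ = #{π : Equiv.Perm α | insert b T ⊆ S.image π} * (Fintype.card α - #T) *
            c ^ (#T + 1) := by ring
      _ = #{π : Equiv.Perm α | T ⊆ S.image π} * c ^ #T * ((#S - #T) * c) := by
          rw [card_perm_insert_subset_image_mul S T b hb]; ring
      _ ≤ _ := Nat.mul_le_mul ih ratio

/-- Let `n ≥ q ≥ k ≥ 3`, `N = 3qn`, let `S ⊆ {1,…,N}` (here `Fin N`) with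
`k - 1 ≤ |S| ≤ q`, and let `[a, a + k - 2]` be an interval of `k - 1` elements
(0-indexed: positions `b` with `a ≤ b < a + (k-1)`). Then the number of
permutations `π` of `{1,…,N}` with `{a,…,a+k-2} ⊆ π(S)`, multiplied by
`(2n)^(k-1)`, is at most `N!`; i.e. this number is at most `N!/(2n)^(k-1)`. -/
theorem stmt11 (n q k : ℕ) (hqn : q ≤ n) (hkq : k ≤ q) (hk : 3 ≤ k)
    (S : Finset (Fin (3 * q * n))) (hS1 : k - 1 ≤ S.card) (hS2 : S.card ≤ q)
    (a : ℕ) (ha : a + (k - 1) ≤ 3 * q * n) :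
    {π : Equiv.Perm (Fin (3 * q * n)) |
        ∀ b : Fin (3 * q * n), a ≤ (b : ℕ) → (b : ℕ) < a + (k - 1) →
          ∃ s ∈ S, π s = b}.ncard * (2 * n) ^ (k - 1) ≤ Nat.factorial (3 * q * n) := by
  let T : Finset (Fin (3 * q * n)) :=
    Finset.univ.filter fun b => a ≤ (b : ℕ) ∧ (b : ℕ) < a + (k - 1)
  have hT : T.card = k - 1 := by
    have map_val : T.map Fin.valEmbedding = Finset.Ico a (a + (k - 1)) := by
      ext x
      simp only [T, Finset.mem_map, Finset.mem_filter_univ, Fin.valEmbedding_apply, Finset.mem_Ico]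
      exact ⟨fun ⟨b, hb, h⟩ => h ▸ hb, fun h => ⟨⟨x, by omega⟩, h, rfl⟩⟩
    rw [← Finset.card_map Fin.valEmbedding, map_val, Nat.card_Ico, Nat.add_sub_cancel_left]
  have main := card_perm_subset_image_mul_pow_le S T (2 * n) (by omega) (by
    rw [Fintype.card_fin]
    nlinarith [Nat.mul_le_mul_right (2 * n) hS2])
  rw [hT, Fintype.card_fin] at main
  convert main using 2
  rw [← Set.ncard_coe_finset]
  congr 1
  ext π
  simp [T, Finset.subset_iff]
end

section
/- Let n, q, k, t be integers with n ≥ q ≥ k ≥ 3 and t < n^{k−3}, and set N = 3qn. Let S_1, …, S_t ⊆ {1, …, N} be sets with |S_i| ≤ q for every i. Then there exists a permutation π of {1, …, N} such that for every i ∈ {1, …, t} and every integer a with 1 ≤ a ≤ N − k + 2, the image π(S_i) does not contain all of {a, a + 1, …, a + k − 2}. -/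
open Finset in
/-- Among the permutations sending `W` into `S`, at most a fraction `|S| / |α|` also sends a given
further point into `S`. -/
theorem card_perm_insert_mul_le {α : Type*} [Fintype α] [DecidableEq α] (S W : Finset α) (x : α)
    (hx : x ∉ W) :
    #{σ : Equiv.Perm α | ∀ w ∈ insert x W, σ w ∈ S} * Fintype.card α ≤
      #{σ : Equiv.Perm α | ∀ w ∈ W, σ w ∈ S} * #S := by
  have swap_le (y : α) : #{σ : Equiv.Perm α | ∀ w ∈ insert x W, σ w ∈ S} ≤
      #{σ ∈ ({σ : Equiv.Perm α | ∀ w ∈ W, σ w ∈ S} : Finset _) | σ y ∈ S} := by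
    by_cases hy : y ∈ W
    · refine card_le_card fun σ hσ => ?_
      simp only [mem_filter, mem_univ, true_and, mem_insert, forall_eq_or_imp] at hσ ⊢
      exact ⟨hσ.2, hσ.2 y hy⟩
    · refine card_le_card_of_injOn (fun σ => σ * Equiv.swap x y) (fun σ hσ => ?_)
        (fun _ _ _ _ h => mul_right_cancel h)
      simp only [coe_filter, mem_filter, Set.mem_ofPred_eq, mem_univ, true_and, mem_insert,
        forall_eq_or_imp, Equiv.Perm.mul_apply, Equiv.swap_apply_right] at hσ ⊢
      refine ⟨fun w hw => ?_, hσ.1⟩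
      rw [Equiv.swap_apply_of_ne_of_ne (ne_of_mem_of_not_mem hw hx) (ne_of_mem_of_not_mem hw hy)]
      exact hσ.2 w hw
  calc _ = ∑ _y : α, #{σ : Equiv.Perm α | ∀ w ∈ insert x W, σ w ∈ S} := by
        rw [sum_const, card_univ, smul_eq_mul, mul_comm]
    _ ≤ ∑ y : α, #{σ ∈ ({σ : Equiv.Perm α | ∀ w ∈ W, σ w ∈ S} : Finset _) | σ y ∈ S} :=
        sum_le_sum fun y _ => swap_le y
    _ = ∑ σ ∈ ({σ : Equiv.Perm α | ∀ w ∈ W, σ w ∈ S} : Finset _), #{y : α | σ y ∈ S} := by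
        simp only [card_filter]
        exact sum_comm
    _ = _ := by
        refine sum_const_nat fun σ _ => ?_
        rw [← card_map σ.symm.toEmbedding (s := S)]
        congr 1
        ext y
        simp

open Finset in
/-- A uniformly random permutation sends `W` into `S` with probability at most
`(|S| / |α|) ^ |W|`. -/
theorem card_perm_mapsTo_mul_pow_le {α : Type*} [Fintype α] [DecidableEq α] (S W : Finset α) :
    #{σ : Equiv.Perm α | ∀ w ∈ W, σ w ∈ S} * Fintype.card α ^ #W ≤
      (Fintype.card α).factorial * #S ^ #W := by
  induction W using Finset.induction_on with
  | empty => simp [Fintype.card_perm]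
  | insert x W hx ih =>
    rw [card_insert_of_notMem hx, pow_succ', pow_succ', ← mul_assoc]
    calc _ ≤ #{σ : Equiv.Perm α | ∀ w ∈ W, σ w ∈ S} * #S * Fintype.card α ^ #W :=
          Nat.mul_le_mul_right _ (card_perm_insert_mul_le S W x hx)
      _ = #{σ : Equiv.Perm α | ∀ w ∈ W, σ w ∈ S} * Fintype.card α ^ #W * #S := by ring
      _ ≤ (Fintype.card α).factorial * #S ^ #W * #S := Nat.mul_le_mul_right _ ih
      _ = _ := by ring

open Finset in
theorem Fin.card_filter_le_lt_add {N a m : ℕ} (h : a + m ≤ N) :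
    #{b : Fin N | a ≤ (b : ℕ) ∧ (b : ℕ) < a + m} = m := by
  rw [← card_map Fin.valEmbedding]
  trans #(Ico a (a + m))
  · congr 1
    ext b
    simp only [mem_map, mem_filter, mem_univ, true_and, Fin.valEmbedding_apply, mem_Ico]
    exact ⟨fun ⟨c, hc, hcb⟩ => hcb ▸ hc, fun hb => ⟨⟨b, by omega⟩, hb, rfl⟩⟩
  · simp

open Finset in
/-- The union bound: if `t` sets of size at most `q` are such that every permutation of `Fin N`
sends some interval of length `m` into one of them, then `N ^ m ≤ t * N * q ^ m`. -/
theorem pow_le_of_forall_perm_interval {N m q t : ℕ} (hm : 0 < m) (S : Fin t → Finset (Fin N))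
    (hS : ∀ i, #(S i) ≤ q)
    (h : ∀ σ : Equiv.Perm (Fin N), ∃ i, ∃ a : ℕ, a + m ≤ N ∧
      ∀ b : Fin N, a ≤ (b : ℕ) → (b : ℕ) < a + m → σ b ∈ S i) :
    N ^ m ≤ t * N * q ^ m := by
  let I (a : ℕ) : Finset (Fin N) := {b | a ≤ (b : ℕ) ∧ (b : ℕ) < a + m}
  let P : Finset (Fin t × ℕ) := univ ×ˢ {a ∈ range N | a + m ≤ N}
  have cover : (univ : Finset (Equiv.Perm (Fin N))) ⊆
      P.biUnion fun p => {σ | ∀ w ∈ I p.2, σ w ∈ S p.1} := by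
    intro σ _
    obtain ⟨i, a, ha, hb⟩ := h σ
    simp only [mem_biUnion, mem_filter, mem_univ, true_and, P, I, mem_product, mem_range]
    exact ⟨(i, a), ⟨by omega, ha⟩, fun w hw => hb w hw.1 hw.2⟩
  have event_le (p : Fin t × ℕ) (hp : p ∈ P) :
      #{σ : Equiv.Perm (Fin N) | ∀ w ∈ I p.2, σ w ∈ S p.1} * N ^ m ≤ N.factorial * q ^ m := by
    simp only [P, mem_product, mem_univ, true_and, mem_filter] at hp
    have := card_perm_mapsTo_mul_pow_le (S p.1) (I p.2)
    rw [Fin.card_filter_le_lt_add hp.2, Fintype.card_fin] at this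
    refine le_trans (le_of_eq ?_) (this.trans (Nat.mul_le_mul_left _ (Nat.pow_le_pow_left (hS p.1) _)))
    congr!
  have card_P : #P ≤ t * N := by
    rw [card_product, card_univ, Fintype.card_fin]
    exact Nat.mul_le_mul_left _ ((card_filter_le _ _).trans (card_range N).le)
  refine Nat.le_of_mul_le_mul_left ?_ N.factorial_pos
  calc N.factorial * N ^ m
      = #(univ : Finset (Equiv.Perm (Fin N))) * N ^ m := by
        rw [card_univ, Fintype.card_perm, Fintype.card_fin]
    _ ≤ (∑ p ∈ P, #{σ : Equiv.Perm (Fin N) | ∀ w ∈ I p.2, σ w ∈ S p.1}) * N ^ m :=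
        Nat.mul_le_mul_right _ ((card_le_card cover).trans card_biUnion_le)
    _ ≤ #P * (N.factorial * q ^ m) := by
        rw [sum_mul]
        exact sum_le_card_nsmul _ _ _ event_le
    _ ≤ t * N * (N.factorial * q ^ m) := Nat.mul_le_mul_right _ card_P
    _ = _ := by ring

/-- Let `n ≥ q ≥ k ≥ 3`, `t < n^(k-3)`, `N = 3qn`, and let `S_1, …, S_t` be
subsets of `{1,…,N}` (here `Fin N`) each of size at most `q`. Then there is a
permutation `π` of `{1,…,N}` such that no image `π(S_i)` covers an interval
with `k - 1` elements. -/
theorem stmt12 (n q k t : ℕ) (hqn : q ≤ n) (hkq : k ≤ q) (hk : 3 ≤ k)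
    (ht : t < n ^ (k - 3))
    (S : Fin t → Finset (Fin (3 * q * n))) (hS : ∀ i, (S i).card ≤ q) :
    ∃ π : Equiv.Perm (Fin (3 * q * n)), ∀ i : Fin t, ∀ a : ℕ,
      a + (k - 1) ≤ 3 * q * n →
        ∃ b : Fin (3 * q * n), a ≤ (b : ℕ) ∧ (b : ℕ) < a + (k - 1) ∧
          ∀ s ∈ S i, π s ≠ b := by
  by_contra! h
  have bound : (3 * q * n) ^ (k - 1) ≤ t * (3 * q * n) * q ^ (k - 1) := by
    refine pow_le_of_forall_perm_interval (by omega) S hS fun σ => ?_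
    obtain ⟨i, a, ha, hb⟩ := h σ⁻¹
    refine ⟨i, a, ha, fun b hab hba => ?_⟩
    obtain ⟨s, hs, rfl⟩ := hb b hab hba
    simpa using hs
  obtain ⟨j, rfl⟩ : ∃ j, k = j + 3 := ⟨k - 3, by omega⟩
  simp only [Nat.add_sub_cancel, show j + 3 - 1 = j + 2 by omega] at bound ht
  have hn : 0 < n := by omega
  have hq : 0 < q ^ (j + 2) := pow_pos (by omega) _
  have cancelled : (3 * n) ^ (j + 2) ≤ t * (3 * q * n) := by
    refine Nat.le_of_mul_le_mul_right ?_ hq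
    rwa [← mul_pow, mul_right_comm]
  refine cancelled.not_gt ?_
  calc t * (3 * q * n) ≤ t * (3 * n * n) := by gcongr
    _ < n ^ j * (3 * n * n) := by gcongr
    _ = 3 ^ 1 * n ^ (j + 2) := by ring
    _ ≤ 3 ^ (j + 2) * n ^ (j + 2) := by gcongr <;> omega
    _ = (3 * n) ^ (j + 2) := (mul_pow _ _ _).symm
end

section
/- Let G be a finite simple graph with a tree decomposition (T, bag) of width at most k, and let H be a graph on the same vertex set with E(G) ⊆ E(H) such that every edge uv ∈ E(H) ∖ E(G) satisfies κ(G, u, v) > k. Then (T, bag) is also a tree decomposition of H; in particular, the treewidth of H is at most k. -/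
/-- `(T, bag)` is a tree decomposition of `G`: `T` is a tree, every vertex of
`G` is in some bag, every edge of `G` is contained in some bag, and for every
vertex of `G` the nodes of `T` whose bags contain it induce a connected
subtree of `T`. -/
def IsTreeDecomposition {V ι : Type*} (G : SimpleGraph V) (T : SimpleGraph ι)
    (bag : ι → Set V) : Prop :=
  T.IsTree ∧
  (∀ v : V, ∃ t, v ∈ bag t) ∧
  (∀ u v : V, G.Adj u v → ∃ t, u ∈ bag t ∧ v ∈ bag t) ∧
  (∀ v : V, ∀ t₁ t₂ : ι, v ∈ bag t₁ → v ∈ bag t₂ →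
    ∃ p : T.Walk t₁ t₂, ∀ t ∈ p.support, v ∈ bag t)

/-- A walk along nodes whose bags contain `w` does not use the edge `ab` if `w` lies outside
`bag a ∩ bag b`. -/
theorem reachable_deleteEdges_of_notMem_adhesion {V ι : Type*} {T : SimpleGraph ι}
    {bag : ι → Set V} {a b : ι} {w : V} (hw : ¬ (w ∈ bag a ∧ w ∈ bag b)) {s t : ι}
    (p : T.Walk s t) (hp : ∀ r ∈ p.support, w ∈ bag r) :
    (T.deleteEdges {s(a, b)}).Reachable s t := by
  refine ⟨p.toDeleteEdges _ fun e he hab => hw ?_⟩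
  rw [Set.mem_singleton_iff] at hab
  subst hab
  exact ⟨hp a (p.fst_mem_support_of_mem_edges he), hp b (p.snd_mem_support_of_mem_edges he)⟩

/-- Walking along a path of the host graph from a node satisfying `Q` to one that does not, there is
an edge `ab` where `Q` fails at `b` and `b` still reaches the end without using `ab`. -/
theorem exists_adj_reachable_deleteEdges {ι : Type*} {T : SimpleGraph ι} {Q : ι → Prop} {s t : ι}
    (p : T.Walk s t) (hp : p.IsPath) (hs : Q s) (ht : ¬ Q t) :
    ∃ a b, T.Adj a b ∧ Q a ∧ ¬ Q b ∧ (T.deleteEdges {s(a, b)}).Reachable b t := by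
  induction p with
  | nil => exact absurd hs ht
  | @cons x y z h q ih =>
    rw [SimpleGraph.Walk.cons_isPath_iff] at hp
    by_cases hy : Q y
    · exact ih hp.1 hy ht
    · refine ⟨x, y, h, hs, hy, ⟨q.toDeleteEdges _ fun e he hab => hp.2 ?_⟩⟩
      rw [Set.mem_singleton_iff] at hab
      subst hab
      exact q.fst_mem_support_of_mem_edges he

/-- A walk of `G` avoiding the adhesion set `bag a ∩ bag b` stays on one side of the edge `ab`. -/
theorem IsTreeDecomposition.reachable_of_walk {V ι : Type*} {G : SimpleGraph V}
    {T : SimpleGraph ι} {bag : ι → Set V} (hd : IsTreeDecomposition G T bag) {a b : ι} {x y : V}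
    (p : G.Walk x y) (hp : ∀ w ∈ p.support, ¬ (w ∈ bag a ∧ w ∈ bag b)) {s t : ι}
    (hs : x ∈ bag s) (ht : y ∈ bag t) : (T.deleteEdges {s(a, b)}).Reachable s t := by
  induction p generalizing s with
  | nil =>
    obtain ⟨q, hq⟩ := hd.2.2.2 _ s t hs ht
    exact reachable_deleteEdges_of_notMem_adhesion (hp _ (by simp)) q hq
  | @cons x y z h p ih =>
    obtain ⟨c, hxc, hyc⟩ := hd.2.2.1 _ _ h
    obtain ⟨q, hq⟩ := hd.2.2.2 _ s c hs hxc
    exact (reachable_deleteEdges_of_notMem_adhesion (hp x (by simp)) q hq).trans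
      (ih (fun w hw => hp w (by simp [hw])) hyc ht)

/-- If no bag contains both `u` and `v`, then some adhesion set contained in a bag of `u`
separates `u` from `v`. -/
theorem IsTreeDecomposition.exists_separating_adhesion {V ι : Type*} {G : SimpleGraph V}
    {T : SimpleGraph ι} {bag : ι → Set V} (hd : IsTreeDecomposition G T bag) {u v : V}
    (huv : ∀ t, u ∈ bag t → v ∉ bag t) :
    ∃ a b, u ∈ bag a ∧ u ∉ bag b ∧
      ∀ p : G.Walk u v, ∃ w ∈ p.support, w ∈ bag a ∧ w ∈ bag b := by
  classical
  obtain ⟨s, hs⟩ := hd.2.1 u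
  obtain ⟨t, ht⟩ := hd.2.1 v
  obtain ⟨q, hq⟩ := (hd.1.connected s t).exists_isPath
  obtain ⟨a, b, hab, hua, hub, hbt⟩ :=
    exists_adj_reachable_deleteEdges (Q := fun r => u ∈ bag r) q hq hs fun h => huv t h ht
  refine ⟨a, b, hua, hub, fun p => ?_⟩
  by_contra! hp
  have hat := hd.reachable_of_walk (a := a) (b := b) p (fun w hw h => hp w hw h.1 h.2) hua ht
  have hbridge := SimpleGraph.isAcyclic_iff_forall_adj_isBridge.1 hd.1.isAcyclic hab
  exact SimpleGraph.isBridge_iff.1 hbridge (hat.trans hbt.symm)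

theorem SimpleGraph.Walk.mem_tail_dropLast_support {V : Type*} {G : SimpleGraph V} {u v w : V}
    (p : G.Walk u v) (hw : w ∈ p.support) (hu : w ≠ u) (hv : w ≠ v) :
    w ∈ p.support.tail.dropLast := by
  have htail : w ∈ p.support.tail := by
    rw [SimpleGraph.Walk.mem_support_iff] at hw
    exact hw.resolve_left hu
  have hne : p.support.tail ≠ [] := List.ne_nil_of_mem htail
  rw [← List.dropLast_append_getLast hne, List.mem_append, List.mem_singleton,
    List.getLast_tail, p.getLast_support] at htail
  exact htail.resolve_right hv

/-- A set meeting every `u`-`v` walk outside `u` and `v` bounds the number of internally disjoint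
`u`-`v` paths. -/
theorem InternallyDisjointPaths.le_ncard {V : Type*} [Finite V] {G : SimpleGraph V} {u v : V}
    {n : ℕ} {P : Fin n → G.Path u v} (hP : InternallyDisjointPaths G P) {S : Set V}
    (hu : u ∉ S) (hv : v ∉ S) (hS : ∀ p : G.Walk u v, ∃ w ∈ p.support, w ∈ S) :
    n ≤ S.ncard := by
  choose f hf hfS using fun i => hS (P i).val
  have hint (i) : f i ∈ (P i).val.support.tail.dropLast :=
    (P i).val.mem_tail_dropLast_support (hf i) (fun h => hu (h ▸ hfS i)) fun h => hv (h ▸ hfS i)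
  have hinj : Function.Injective f := fun i j hij => by
    by_contra hne
    exact hP.2 i j hne (hint i) (hij ▸ hint j)
  calc n = (Set.range f).ncard := by
        rw [← Set.image_univ, Set.ncard_image_of_injective _ hinj]; simp
    _ ≤ S.ncard := Set.ncard_le_ncard (Set.range_subset_iff.2 hfS)

/-- Let `(T, bag)` be a tree decomposition of `G` of width at most `k`, and let
`H ⊇ G` be a graph on the same vertex set such that every edge of `H` not in
`G` joins vertices `u, v` with `κ(G, u, v) > k`. Then `(T, bag)` is also a
tree decomposition of `H` (in particular, the treewidth of `H` is at most `k`). -/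
theorem stmt14 {V : Type*} [Fintype V] (G H : SimpleGraph V) (k : ℤ)
    {ι : Type*} (T : SimpleGraph ι) (bag : ι → Set V)
    (hdecomp : IsTreeDecomposition G T bag)
    (hwidth : ∀ t : ι, ((bag t).ncard : ℤ) ≤ k + 1)
    (hGH : G ≤ H)
    (hextra : ∀ u v : V, H.Adj u v → ¬ G.Adj u v → k < (kappa G u v : ℤ)) :
    IsTreeDecomposition H T bag := by
  refine ⟨hdecomp.1, hdecomp.2.1, fun u v huv => ?_, hdecomp.2.2.2⟩
  by_cases hG : G.Adj u v
  · exact hdecomp.2.2.1 u v hG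
  by_contra! hno
  obtain ⟨a, b, hua, hub, hsep⟩ := hdecomp.exists_separating_adhesion hno
  have hlt : (bag a ∩ bag b).ncard < (bag a).ncard :=
    Set.ncard_lt_ncard ⟨Set.inter_subset_left, fun h => hub (h hua).2⟩
  have hk := hextra u v huv hG
  have ha := hwidth a
  obtain ⟨P, hP⟩ := exists_internallyDisjointPaths_kappa (G := G) (u := u) (v := v) (by omega)
  have := hP.le_ncard (S := bag a ∩ bag b) (fun h => hub h.2) (fun h => hno a hua h.1) hsep
  omega
end

section
/- Let G be a finite simple graph, let u, v be distinct non-adjacent vertices of G, and let S ⊆ V(G) be a set with u, v ∈ S. Suppose that for every connected component C of G ∖ S there is a set X_C ⊆ C such that u and v lie in different connected components of G[C ∪ {u, v}] ∖ X_C. Then u and v lie in different connected components of G ∖ ((S ∖ {u, v}) ∪ ⋃_C X_C); that is, (S ∖ {u, v}) ∪ ⋃_C X_C is a u-v-separator in G. -/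
/-- `x` and `y` lie in the same connected component of `G[A] ∖ X`: there is a
walk from `x` to `y` in `G` staying inside `A` and avoiding `X`. -/
def ConnWithinAvoiding {V : Type*} (G : SimpleGraph V) (A X : Set V) (x y : V) : Prop :=
  ∃ p : G.Walk x y, (∀ z ∈ p.support, z ∈ A) ∧ ∀ z ∈ p.support, z ∉ X

/-- `C` is a connected component of `G ∖ S` (regarded as a set of vertices):
it is a nonempty set disjoint from `S`, any two of its vertices are connected
in `G ∖ S`, and it is closed under connectivity in `G ∖ S`. -/
def IsComponentAvoiding {V : Type*} (G : SimpleGraph V) (S C : Set V) : Prop :=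
  C.Nonempty ∧ Disjoint C S ∧
    (∀ x ∈ C, ∀ y ∈ C, ConnAvoiding G S x y) ∧
    (∀ x ∈ C, ∀ y : V, ConnAvoiding G S x y → y ∈ C)

/-- The vertices reachable from `x ∉ S` in `G ∖ S` form a connected component of `G ∖ S`. -/
lemma isComponentAvoiding_setOf_connAvoiding {V : Type*} (G : SimpleGraph V) {S : Set V} {x : V}
    (hx : x ∉ S) : IsComponentAvoiding G S {y | ConnAvoiding G S x y} := by
  refine ⟨⟨x, .nil, by simpa using hx⟩, ?_, ?_, ?_⟩
  · rw [Set.disjoint_left]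
    rintro y ⟨p, hp⟩
    exact hp y p.end_mem_support
  · rintro y ⟨p, hp⟩ z ⟨q, hq⟩
    refine ⟨p.reverse.append q, fun w hw => ?_⟩
    rw [SimpleGraph.Walk.mem_support_append_iff] at hw
    rcases hw with hw | hw
    · exact hp w (by simpa using hw)
    · exact hq w hw
  · rintro y ⟨p, hp⟩ z ⟨q, hq⟩
    refine ⟨p.append q, fun w hw => ?_⟩
    rw [SimpleGraph.Walk.mem_support_append_iff] at hw
    exact hw.elim (hp w) (hq w)

/-- A walk from a component `C` of `G ∖ S` to `v ∈ S` that meets `S` only in `v` and avoids `Y`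
can be shortened to one that stays in `C` until it reaches `v`. -/
lemma IsComponentAvoiding.connWithinAvoiding_insert {V : Type*} {G : SimpleGraph V}
    {S C Y : Set V} (hC : IsComponentAvoiding G S C) {x v : V} (hv : v ∈ S) (p : G.Walk x v)
    (hx : x ∈ C) (hS : ∀ z ∈ p.support, z ∈ S → z = v) (hY : ∀ z ∈ p.support, z ∉ Y) :
    ConnWithinAvoiding G (insert v C) Y x v := by
  induction p with
  | nil => exact absurd hv (Set.disjoint_left.mp hC.2.1 hx)
  | @cons x y v h q ih =>
    simp only [SimpleGraph.Walk.support_cons, List.mem_cons, forall_eq_or_imp] at hS hY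
    have hq : ConnWithinAvoiding G (insert v C) Y y v := by
      by_cases hyv : y = v
      · subst hyv
        exact ⟨.nil, by simp, by simpa using hY.2 y q.start_mem_support⟩
      · have hyS : y ∉ S := fun hy => hyv (hS.2 y q.start_mem_support hy)
        have hyC : y ∈ C := hC.2.2.2 x hx y
          ⟨h.toWalk, by simpa using ⟨Set.disjoint_left.mp hC.2.1 hx, hyS⟩⟩
        exact ih hv hyC hS.2 hY.2
    obtain ⟨r, hr, hrY⟩ := hq
    refine ⟨.cons h r, ?_, ?_⟩ <;>
      simp only [SimpleGraph.Walk.support_cons, List.mem_cons, forall_eq_or_imp]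
    · exact ⟨Or.inr hx, hr⟩
    · exact ⟨hY.1, hrY⟩

/-- Let `u, v` be distinct non-adjacent vertices and `S ∋ u, v`. If for every
connected component `C` of `G ∖ S` a set `X C ⊆ C` separates `u` from `v` in
`G[C ∪ {u, v}]`, then `(S ∖ {u,v}) ∪ ⋃_C X C` separates `u` from `v` in `G`. -/
theorem stmt16 {V : Type*} [Fintype V] (G : SimpleGraph V) (u v : V) (huv : u ≠ v)
    (hadj : ¬ G.Adj u v) (S : Set V) (hu : u ∈ S) (hv : v ∈ S)
    (X : Set V → Set V)
    (hX : ∀ C : Set V, IsComponentAvoiding G S C →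
      X C ⊆ C ∧ ¬ ConnWithinAvoiding G (C ∪ {u, v}) (X C) u v) :
    ¬ ConnAvoiding G
        ((S \ {u, v}) ∪ ⋃ C ∈ {D : Set V | IsComponentAvoiding G S D}, X C) u v := by
  classical
  rintro ⟨p₀, hp₀⟩
  have hp : ∀ z ∈ p₀.bypass.support, _ := fun z hz => hp₀ z (p₀.support_bypass_subset_support hz)
  have hpath := p₀.bypass_isPath
  generalize p₀.bypass = p at hp hpath
  cases p with
  | nil => exact huv rfl
  | @cons _ x _ h q =>
    rw [SimpleGraph.Walk.cons_isPath_iff] at hpath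
    simp only [SimpleGraph.Walk.support_cons, List.mem_cons, forall_eq_or_imp] at hp
    have hS : ∀ z ∈ q.support, z ∈ S → z = v := by
      intro z hz hzS
      by_contra hzv
      refine hp.2 z hz (Or.inl ⟨hzS, ?_⟩)
      rintro (rfl | rfl)
      · exact hpath.2 hz
      · exact hzv rfl
    have hxS : x ∉ S := fun hx => hadj (hS x q.start_mem_support hx ▸ h)
    have hC := isComponentAvoiding_setOf_connAvoiding G hxS
    set C := {y | ConnAvoiding G S x y}
    obtain ⟨hXC, hsep⟩ := hX C hC
    obtain ⟨r, hr, hrX⟩ := hC.connWithinAvoiding_insert (Y := X C) hv q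
      ⟨.nil, by simpa using hxS⟩ hS
      fun z hz hzX => hp.2 z hz (Or.inr (Set.mem_biUnion hC hzX))
    refine hsep ⟨.cons h r, ?_, ?_⟩ <;>
      simp only [SimpleGraph.Walk.support_cons, List.mem_cons, forall_eq_or_imp]
    · refine ⟨by simp, fun z hz => ?_⟩
      rcases hr z hz with rfl | hz
      · simp
      · exact Or.inl hz
    · exact ⟨fun huX => Set.disjoint_left.mp hC.2.1 (hXC huX) hu, hrX⟩
end
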